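/- If a and b are positive integers such that Hadamard matrices of orders 4a and 4b both exist, then there exists a Hadamard matrix of order 8ab. -/

import Mathlib

/-- A Hadamard matrix of order `n`: an `n × n` real matrix with entries in `{-1, +1}`
satisfying `H * Hᵀ = n • I`. -/
def IsHadamardMatrix {n : ℕ} (H : Matrix (Fin n) (Fin n) ℝ) : Prop :=
  (∀ i j, H i j = 1 ∨ H i j = -1) ∧ H * H.transpose = (n : ℝ) • 1

/-- There exists a Hadamard matrix of order `n`. -/
def HadamardOrder (n : ℕ) : Prop :=
  ∃ H : Matrix (Fin n) (Fin n) ℝ, IsHadamardMatrix H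

open scoped Kronecker

/-- A square `±1` matrix whose rows and columns are indexed by arbitrary types of size `n` and whose
Gram matrix is `n • 1` yields a Hadamard matrix of order `n`. -/
theorem HadamardOrder.of_matrix {ι κ : Type*} [Fintype ι] [Fintype κ] [DecidableEq ι] {n : ℕ}
    (hι : Fintype.card ι = n) (hκ : Fintype.card κ = n) (M : Matrix ι κ ℝ)
    (hM : ∀ i j, M i j = 1 ∨ M i j = -1) (hMM : M * M.transpose = (n : ℝ) • 1) :
    HadamardOrder n := by
  let e := (Fintype.equivFinOfCardEq hι).symm
  let f := (Fintype.equivFinOfCardEq hκ).symm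
  refine ⟨M.submatrix e f, fun i j => hM _ _, ?_⟩
  rw [Matrix.transpose_submatrix, Matrix.submatrix_mul_equiv, hMM, Matrix.submatrix_smul,
    Pi.smul_apply, Pi.smul_apply, Matrix.submatrix_one_equiv]

/-- The columns of a Hadamard matrix of even order split into two halves. -/
theorem HadamardOrder.exists_column_halves {m : ℕ} (h : HadamardOrder (m + m)) :
    ∃ A B : Matrix (Fin (m + m)) (Fin m) ℝ,
      (∀ i j, A i j = 1 ∨ A i j = -1) ∧ (∀ i j, B i j = 1 ∨ B i j = -1) ∧
      A * A.transpose + B * B.transpose = ((m + m : ℕ) : ℝ) • 1 := by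
  obtain ⟨H, hH, hHH⟩ := h
  refine ⟨H.submatrix id (Fin.castAdd m), H.submatrix id (Fin.natAdd m),
    fun i j => hH _ _, fun i j => hH _ _, ?_⟩
  rw [← hHH]
  ext i j
  simp [Matrix.mul_apply, Fin.sum_univ_add]

/-- The rows of a Hadamard matrix of even order split into two mutually orthogonal halves. -/
theorem HadamardOrder.exists_row_halves {m : ℕ} (h : HadamardOrder (m + m)) :
    ∃ C D : Matrix (Fin m) (Fin (m + m)) ℝ,
      (∀ i j, C i j = 1 ∨ C i j = -1) ∧ (∀ i j, D i j = 1 ∨ D i j = -1) ∧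
      C * C.transpose = ((m + m : ℕ) : ℝ) • 1 ∧ D * D.transpose = ((m + m : ℕ) : ℝ) • 1 ∧
      C * D.transpose = 0 ∧ D * C.transpose = 0 := by
  obtain ⟨H, hH, hHH⟩ := h
  have key (i j) : ∑ k, H i k * H j k = ((m + m : ℕ) : ℝ) * if i = j then 1 else 0 := by
    simpa [Matrix.mul_apply, Matrix.one_apply] using congrFun (congrFun hHH i) j
  refine ⟨H.submatrix (Fin.castAdd m) id, H.submatrix (Fin.natAdd m) id,
    fun i j => hH _ _, fun i j => hH _ _, ?_, ?_, ?_, ?_⟩ <;>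
  · ext i j
    simp only [Matrix.mul_apply, Matrix.transpose_apply, Matrix.submatrix_apply, id, key,
      Matrix.smul_apply, Matrix.one_apply, smul_eq_mul, Matrix.zero_apply]
    simp [Fin.ext_iff]
    try lia

/-- Hadamard matrices of even orders `2m` and `2n` give one of order `2mn`. -/
theorem HadamardOrder.mul_halves {m n : ℕ} (hm : HadamardOrder (m + m))
    (hn : HadamardOrder (n + n)) : HadamardOrder ((m + m) * n) := by
  obtain ⟨A, B, hA, hB, hAB⟩ := hm.exists_column_halves
  obtain ⟨C, D, hC, hD, hCC, hDD, hCD, hDC⟩ := hn.exists_row_halves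
  let P : Matrix (Fin (m + m)) (Fin m) ℝ := (1 / 2 : ℝ) • (A + B)
  let Q : Matrix (Fin (m + m)) (Fin m) ℝ := (1 / 2 : ℝ) • (A - B)
  have hPQ : P * P.transpose + Q * Q.transpose = (m : ℝ) • 1 := by
    have : P * P.transpose + Q * Q.transpose
        = (1 / 2 : ℝ) • (A * A.transpose + B * B.transpose) := by
      simp only [P, Q, Matrix.transpose_smul, Matrix.transpose_add, Matrix.transpose_sub,
        Matrix.smul_mul, Matrix.mul_smul, Matrix.add_mul, Matrix.mul_add, Matrix.sub_mul,
        Matrix.mul_sub]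
      module
    rw [this, hAB, smul_smul]
    congr 1
    push_cast
    ring
  refine .of_matrix (by simp) (by simp; ring) (P ⊗ₖ C + Q ⊗ₖ D) ?_ ?_
  · rintro ⟨i, k⟩ ⟨j, l⟩
    simp only [P, Q, Matrix.add_apply, Matrix.kronecker_apply, Matrix.smul_apply,
      Matrix.sub_apply, smul_eq_mul]
    rcases hA i j with h₁ | h₁ <;> rcases hB i j with h₂ | h₂ <;>
      rcases hC k l with h₃ | h₃ <;> rcases hD k l with h₄ | h₄ <;>
      norm_num [h₁, h₂, h₃, h₄]
  · have expand : (P ⊗ₖ C + Q ⊗ₖ D) * (P ⊗ₖ C + Q ⊗ₖ D).transpose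
        = (P * P.transpose + Q * Q.transpose) ⊗ₖ (((n + n : ℕ) : ℝ) • 1) := by
      simp only [Matrix.transpose_add, ← Matrix.kroneckerMap_transpose, Matrix.add_mul,
        Matrix.mul_add, ← Matrix.mul_kronecker_mul, hCC, hDD, hCD, hDC, Matrix.kronecker_zero,
        Matrix.add_kronecker, add_zero, zero_add]
    rw [expand, hPQ, Matrix.smul_kronecker, Matrix.kronecker_smul, Matrix.one_kronecker_one,
      smul_smul]
    congr 1
    push_cast
    ring

theorem hadamard_product_8ab (a b : ℕ) (ha : 0 < a) (hb : 0 < b)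
    (hA : HadamardOrder (4 * a)) (hB : HadamardOrder (4 * b)) :
    HadamardOrder (8 * (a * b)) := by
  rw [show 4 * a = 2 * a + 2 * a by ring] at hA
  rw [show 4 * b = 2 * b + 2 * b by ring] at hB
  rw [show 8 * (a * b) = (2 * a + 2 * a) * (2 * b) by ring]
  exact hA.mul_halves hB
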